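/- Lower bound for tripartite entanglement of purification: Δ_P(A:B:C) ≥ max{S_A + S_B + S_C − S_{ABC}, 2(S_A + S_B + S_C) − S_{AB} − S_{BC} − S_{CA}} for any tripartite state ρ_{ABC}. -/

import Mathlib

open scoped BigOperators ComplexOrder

noncomputable section

/-- Von Neumann entropy of a matrix: `−∑ λᵢ log λᵢ` over its eigenvalues
(defined to be `0` if the matrix is not Hermitian). -/
noncomputable def matEntropy {ι : Type} [Fintype ι] [DecidableEq ι]
    (ρ : Matrix ι ι ℂ) : ℝ :=
  if h : ρ.IsHermitian then ∑ i, Real.negMulLog (h.eigenvalues i) else 0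

/-- A density matrix: positive semidefinite with unit trace. -/
def IsDensityMatrix {ι : Type} [Fintype ι] (ρ : Matrix ι ι ℂ) : Prop :=
  ρ.PosSemidef ∧ ρ.trace = 1

instance sumElimFintype {κ π : Type} {α : κ → Type} {δ : π → Type}
    [∀ i, Fintype (α i)] [∀ k, Fintype (δ k)] :
    ∀ i : κ ⊕ π, Fintype (Sum.elim α δ i)
  | .inl a => inferInstanceAs (Fintype (α a))
  | .inr b => inferInstanceAs (Fintype (δ b))

instance sumElimDecEq {κ π : Type} {α : κ → Type} {δ : π → Type}
    [∀ i, DecidableEq (α i)] [∀ k, DecidableEq (δ k)] :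
    ∀ i : κ ⊕ π, DecidableEq (Sum.elim α δ i)
  | .inl a => inferInstanceAs (DecidableEq (α a))
  | .inr b => inferInstanceAs (DecidableEq (δ b))

/-- Reduced density matrix on the subsystems in `s` (partial trace over the rest). -/
noncomputable def reduce {κ : Type} [Fintype κ] [DecidableEq κ] {α : κ → Type}
    [∀ i, Fintype (α i)] (s : Finset κ)
    (ρ : Matrix (∀ i, α i) (∀ i, α i) ℂ) :
    Matrix (∀ i : {j // j ∈ s}, α i.1) (∀ i : {j // j ∈ s}, α i.1) ℂ :=
  Matrix.of fun f g => ∑ h : ∀ i : {j // j ∉ s}, α i.1,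
    ρ (fun i => if hi : i ∈ s then f ⟨i, hi⟩ else h ⟨i, hi⟩)
      (fun i => if hi : i ∈ s then g ⟨i, hi⟩ else h ⟨i, hi⟩)

/-- The (pure) density matrix `|ψ⟩⟨ψ|` of a state vector. -/
def vecState {ι : Type} (ψ : ι → ℂ) : Matrix ι ι ℂ :=
  Matrix.of fun x y => ψ x * star (ψ y)

/-- Multipartite mutual information `∑ᵢ S_{Aᵢ} − S_{A₁⋯Aₙ}`. -/
noncomputable def Imulti {κ : Type} [Fintype κ] [DecidableEq κ] {α : κ → Type}
    [∀ i, Fintype (α i)] [∀ i, DecidableEq (α i)]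
    (ρ : Matrix (∀ i, α i) (∀ i, α i) ℂ) : ℝ :=
  (∑ i, matEntropy (reduce {i} ρ)) - matEntropy ρ

/-- Merge an assignment on the original systems with one on the ancillas. -/
def mergeSum {κ π : Type} {α : κ → Type} {δ : π → Type}
    (f : ∀ i, α i) (h : ∀ k, δ k) : ∀ i : κ ⊕ π, Sum.elim α δ i
  | .inl a => f a
  | .inr b => h b

/-- The subsystems belonging to party `k` together with its ancilla. -/
def partyFinset {κ π : Type} [Fintype κ] [DecidableEq κ] [DecidableEq π]
    (p : κ → π) (k : π) : Finset (κ ⊕ π) :=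
  (Finset.univ.filter fun i => p i = k).image Sum.inl ∪ {Sum.inr k}

/-- `ψ` (on the original systems plus one ancilla `Fin (d k)` per party)
purifies `ρ`: tracing out all ancillas from `|ψ⟩⟨ψ|` gives back `ρ`. -/
def Purifies {κ π : Type} [Fintype κ] {α : κ → Type} [∀ i, Fintype (α i)]
    [Fintype π] [DecidableEq π] {d : π → ℕ}
    (ψ : (∀ i : κ ⊕ π, Sum.elim α (fun k => Fin (d k)) i) → ℂ)
    (ρ : Matrix (∀ i, α i) (∀ i, α i) ℂ) : Prop :=
  ∀ f g, (∑ h : ∀ k, Fin (d k), vecState ψ (mergeSum f h) (mergeSum g h)) = ρ f g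

/-- Multipartite entanglement of purification for the partition of the systems `κ`
into parties `π` given by `p`: the infimum over all purifications (with one ancilla
per party, of arbitrary finite dimension) of `∑ₖ S_{AₖAₖ'}`. -/
noncomputable def DeltaPart {κ π : Type} [Fintype κ] [DecidableEq κ]
    [Fintype π] [DecidableEq π] {α : κ → Type}
    [∀ i, Fintype (α i)] [∀ i, DecidableEq (α i)]
    (p : κ → π) (ρ : Matrix (∀ i, α i) (∀ i, α i) ℂ) : ℝ :=
  sInf { x | ∃ (d : π → ℕ) (ψ : (∀ i : κ ⊕ π, Sum.elim α (fun k => Fin (d k)) i) → ℂ),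
    Purifies ψ ρ ∧
    x = ∑ k : π, matEntropy (reduce (partyFinset p k) (vecState ψ)) }

/-- Bipartite-style entanglement of purification for the partition `p`:
the infimum over purifications of the entropy of the single party `k₀`
together with its ancilla. -/
noncomputable def EPart {κ π : Type} [Fintype κ] [DecidableEq κ]
    [Fintype π] [DecidableEq π] {α : κ → Type}
    [∀ i, Fintype (α i)] [∀ i, DecidableEq (α i)]
    (p : κ → π) (k₀ : π) (ρ : Matrix (∀ i, α i) (∀ i, α i) ℂ) : ℝ :=
  sInf { x | ∃ (d : π → ℕ) (ψ : (∀ i : κ ⊕ π, Sum.elim α (fun k => Fin (d k)) i) → ℂ),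
    Purifies ψ ρ ∧
    x = matEntropy (reduce (partyFinset p k₀) (vecState ψ)) }

open scoped Kronecker Matrix

section Entropy

variable {m n : Type} [Fintype m] [DecidableEq m] [Fintype n] [DecidableEq n]

theorem matEntropy_of_isHermitian {M : Matrix m m ℂ} (h : M.IsHermitian) :
    matEntropy M = ∑ i, Real.negMulLog (h.eigenvalues i) := dif_pos h

theorem matEntropy_eq_sum_roots {M : Matrix m m ℂ} (h : M.IsHermitian) :
    matEntropy M = (M.charpoly.roots.map fun z => Real.negMulLog z.re).sum := by
  rw [matEntropy_of_isHermitian h, h.roots_charpoly_eq_eigenvalues, Multiset.map_map]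
  rfl

theorem matEntropy_mul_comm (A : Matrix m n ℂ) (B : Matrix n m ℂ)
    (hAB : (A * B).IsHermitian) (hBA : (B * A).IsHermitian) :
    matEntropy (A * B) = matEntropy (B * A) := by
  have h := congrArg Polynomial.roots (Matrix.charpoly_mul_comm' A B)
  rw [Polynomial.roots_mul (mul_ne_zero (pow_ne_zero _ Polynomial.X_ne_zero)
      (Matrix.charpoly_monic _).ne_zero), Polynomial.roots_mul (mul_ne_zero
      (pow_ne_zero _ Polynomial.X_ne_zero) (Matrix.charpoly_monic _).ne_zero)] at h
  have h' := congrArg (fun s => (s.map fun z : ℂ => Real.negMulLog z.re).sum) h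
  simpa [Multiset.map_nsmul, Multiset.sum_nsmul, matEntropy_eq_sum_roots, hAB, hBA] using h'

theorem matEntropy_submatrix_equiv {M : Matrix m m ℂ} (h : M.IsHermitian) (e : n ≃ m) :
    matEntropy (M.submatrix e e) = matEntropy M := by
  rw [matEntropy_eq_sum_roots (h.submatrix e), matEntropy_eq_sum_roots h,
    ← Matrix.charpoly_reindex e.symm M]
  simp

theorem matEntropy_transpose {M : Matrix m m ℂ} (h : M.IsHermitian) :
    matEntropy Mᵀ = matEntropy M := by
  rw [matEntropy_eq_sum_roots h.transpose, matEntropy_eq_sum_roots h, Matrix.charpoly_transpose]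

theorem matEntropy_unique [Unique m] {M : Matrix m m ℂ} (h : M.IsHermitian) (h1 : M.trace = 1) :
    matEntropy M = 0 := by
  have h2 := h.trace_eq_sum_eigenvalues
  rw [matEntropy_of_isHermitian h]
  simp only [Fintype.sum_unique, h1] at h2 ⊢
  have h3 : h.eigenvalues default = 1 := Complex.ofReal_injective (by simpa using h2.symm)
  rw [h3, Real.negMulLog_one]

end Entropy

section QuadForm

variable {m n : Type} [Fintype m] [DecidableEq m] [Fintype n] [DecidableEq n]

/-- A concave quadratic functional of `Y`. Its supremum over `Y` is a quasi-entropy of `ρ`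
relative to `σ`. -/
def quadForm (s : ℝ) (ρ σ Y : Matrix n n ℂ) : ℝ :=
  2 * ((Yᴴ * ρ).trace - (Yᴴ * σ).trace).re - (Y * Yᴴ * σ).trace.re - s * (Yᴴ * Y * ρ).trace.re

/-- The matrix with eigenvalues `q` and eigenvectors the columns of `U`. -/
def conjDiag (U : Matrix n n ℂ) (q : n → ℝ) : Matrix n n ℂ :=
  U * Matrix.diagonal (fun i => (q i : ℂ)) * Uᴴ

theorem quadForm_conjDiag (s : ℝ) {U V : Matrix n n ℂ} (hU : Uᴴ * U = 1) (hV : Vᴴ * V = 1)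
    (p q : n → ℝ) (Z : Matrix n n ℂ) :
    quadForm s (conjDiag V p) (conjDiag U q) (U * Z * Vᴴ) =
      ∑ i, ∑ j, (2 * (p j - q i) * (star (Z i j) * (Uᴴ * V) i j).re
        - (q i + s * p j) * Complex.normSq (Z i j)) := by
  have h1 : ((U * Z * Vᴴ)ᴴ * conjDiag V p).trace =
      ∑ i, ∑ j, star (Z i j) * (Uᴴ * V) i j * p j := by
    have : (U * Z * Vᴴ)ᴴ * conjDiag V p =
        V * (Zᴴ * (Uᴴ * V) * Matrix.diagonal (fun i => (p i : ℂ)) * Vᴴ) := by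
      simp only [conjDiag, Matrix.conjTranspose_mul, Matrix.conjTranspose_conjTranspose,
        Matrix.mul_assoc]
    rw [this, Matrix.trace_mul_comm, Matrix.mul_assoc, hV, Matrix.mul_one, Matrix.trace,
      Finset.sum_comm]
    refine Finset.sum_congr rfl fun j _ => ?_
    rw [Matrix.diag_apply, Matrix.mul_diagonal, Matrix.mul_apply, Finset.sum_mul]
    rfl
  have h2 : ((U * Z * Vᴴ)ᴴ * conjDiag U q).trace =
      ∑ i, ∑ j, star (Z i j) * (Uᴴ * V) i j * q i := by
    have : (U * Z * Vᴴ)ᴴ * conjDiag U q =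
        V * (Zᴴ * ((Uᴴ * U) * Matrix.diagonal (fun i => (q i : ℂ)) * Uᴴ)) := by
      simp only [conjDiag, Matrix.conjTranspose_mul, Matrix.conjTranspose_conjTranspose,
        Matrix.mul_assoc]
    rw [this, hU, Matrix.one_mul, Matrix.trace_mul_comm, Matrix.mul_assoc, Matrix.mul_assoc,
      Matrix.trace, Finset.sum_comm]
    refine Finset.sum_congr rfl fun j _ => ?_
    rw [Matrix.diag_apply, Matrix.mul_apply]
    refine Finset.sum_congr rfl fun i _ => ?_
    rw [Matrix.diagonal_mul, Matrix.conjTranspose_apply]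
    ring
  have h3 : ((U * Z * Vᴴ) * (U * Z * Vᴴ)ᴴ * conjDiag U q).trace =
      ∑ i, ∑ j, (Complex.normSq (Z i j) : ℂ) * q i := by
    have : (U * Z * Vᴴ) * (U * Z * Vᴴ)ᴴ * conjDiag U q =
        U * (Z * (Vᴴ * V) * Zᴴ * (Uᴴ * U) * Matrix.diagonal (fun i => (q i : ℂ)) * Uᴴ) := by
      simp only [conjDiag, Matrix.conjTranspose_mul, Matrix.conjTranspose_conjTranspose,
        Matrix.mul_assoc]
    rw [this, Matrix.trace_mul_comm, Matrix.mul_assoc, hU, hV, Matrix.mul_one, Matrix.mul_one,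
      Matrix.mul_one, Matrix.trace]
    refine Finset.sum_congr rfl fun i _ => ?_
    rw [Matrix.diag_apply, Matrix.mul_diagonal, Matrix.mul_apply, Finset.sum_mul]
    refine Finset.sum_congr rfl fun j _ => ?_
    rw [Matrix.conjTranspose_apply, ← Complex.mul_conj]
    rfl
  have h4 : ((U * Z * Vᴴ)ᴴ * (U * Z * Vᴴ) * conjDiag V p).trace =
      ∑ i, ∑ j, (Complex.normSq (Z i j) : ℂ) * p j := by
    have : (U * Z * Vᴴ)ᴴ * (U * Z * Vᴴ) * conjDiag V p =
        V * (Zᴴ * (Uᴴ * U) * Z * (Vᴴ * V) * Matrix.diagonal (fun i => (p i : ℂ)) * Vᴴ) := by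
      simp only [conjDiag, Matrix.conjTranspose_mul, Matrix.conjTranspose_conjTranspose,
        Matrix.mul_assoc]
    rw [this, Matrix.trace_mul_comm, Matrix.mul_assoc, hU, hV, Matrix.mul_one, Matrix.mul_one,
      Matrix.mul_one, Matrix.trace, Finset.sum_comm]
    refine Finset.sum_congr rfl fun j _ => ?_
    rw [Matrix.diag_apply, Matrix.mul_diagonal, Matrix.mul_apply, Finset.sum_mul]
    refine Finset.sum_congr rfl fun i _ => ?_
    rw [Matrix.conjTranspose_apply, Complex.normSq_eq_conj_mul_self]
    rfl
  rw [quadForm, h1, h2, h3, h4]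
  simp only [← Finset.sum_sub_distrib, Complex.re_sum, Finset.mul_sum, ← Complex.ofReal_mul,
    Complex.ofReal_re, ← mul_sub, ← Complex.ofReal_sub, Complex.re_mul_ofReal]
  refine Finset.sum_congr rfl fun i _ => Finset.sum_congr rfl fun j _ => ?_
  ring

theorem quadForm_conjDiag_le {s : ℝ} (hs : 0 < s) {U V : Matrix n n ℂ} (hU : U * Uᴴ = 1)
    (hV : V * Vᴴ = 1) {p q : n → ℝ} (hp : 0 ≤ p) (hq : 0 ≤ q) (Y : Matrix n n ℂ) :
    quadForm s (conjDiag V p) (conjDiag U q) Y ≤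
      ∑ i, ∑ j, Complex.normSq ((Uᴴ * V) i j) * ((p j - q i) ^ 2 / (q i + s * p j)) := by
  have hY : Y = U * (Uᴴ * Y * V) * Vᴴ := by
    calc Y = (U * Uᴴ) * Y * (V * Vᴴ) := by rw [hU, hV, Matrix.one_mul, Matrix.mul_one]
      _ = _ := by simp only [Matrix.mul_assoc]
  rw [hY, quadForm_conjDiag s (mul_eq_one_comm.mp hU) (mul_eq_one_comm.mp hV)]
  refine Finset.sum_le_sum fun i _ => Finset.sum_le_sum fun j _ => ?_
  generalize (Uᴴ * Y * V) i j = z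
  generalize (Uᴴ * V) i j = w
  have hpj := hp j
  have hqi := hq i
  simp only [Pi.zero_apply] at hpj hqi
  rcases (add_nonneg hqi (mul_nonneg hs.le hpj)).eq_or_lt with h | h
  · have h1 : q i = 0 := by nlinarith [mul_nonneg hs.le hpj]
    have h2 : p j = 0 := by
      have : s * p j = 0 := by linarith
      simpa [hs.ne'] using this
    simp [h1, h2]
  · rw [← mul_div_assoc, le_div_iff₀ h]
    simp only [Complex.normSq_apply, Complex.star_def, Complex.mul_re, Complex.conj_re,
      Complex.conj_im]
    generalize q i + s * p j = t
    generalize p j - q i = r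
    nlinarith [sq_nonneg (r * w.re - t * z.re), sq_nonneg (r * w.im - t * z.im)]

theorem exists_quadForm_conjDiag_eq {s : ℝ} (hs : 0 < s) {U V : Matrix n n ℂ} (hU : U * Uᴴ = 1)
    (hV : V * Vᴴ = 1) {p q : n → ℝ} (hp : 0 ≤ p) (hq : 0 ≤ q) :
    ∃ Y, quadForm s (conjDiag V p) (conjDiag U q) Y =
      ∑ i, ∑ j, Complex.normSq ((Uᴴ * V) i j) * ((p j - q i) ^ 2 / (q i + s * p j)) := by
  refine ⟨U * (Matrix.of fun i j => (((p j - q i) / (q i + s * p j) : ℝ) : ℂ) * (Uᴴ * V) i j)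
    * Vᴴ, ?_⟩
  rw [quadForm_conjDiag s (mul_eq_one_comm.mp hU) (mul_eq_one_comm.mp hV)]
  refine Finset.sum_congr rfl fun i _ => Finset.sum_congr rfl fun j _ => ?_
  rw [Matrix.of_apply]
  generalize (Uᴴ * V) i j = w
  have hpj := hp j
  have hqi := hq i
  simp only [Pi.zero_apply] at hpj hqi
  rcases (add_nonneg hqi (mul_nonneg hs.le hpj)).eq_or_lt with h | h
  · simp [← h]
  · simp only [Complex.normSq_apply, Complex.star_def, Complex.mul_re, Complex.conj_re,
      Complex.conj_im, Complex.mul_im, Complex.ofReal_re, Complex.ofReal_im]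
    have ht := h.ne'
    generalize q i + s * p j = t at ht ⊢
    field_simp
    ring

/-- Monotonicity of the quasi-entropies under the map `ρ ↦ ρ'` dual to a multiplicative
`*`-preserving map `Ψ`. -/
theorem quasiEntropy_mono {s : ℝ} (hs : 0 < s) {U V : Matrix m m ℂ} (hU : U * Uᴴ = 1)
    (hV : V * Vᴴ = 1) {p q : m → ℝ} (hp : 0 ≤ p) (hq : 0 ≤ q)
    {U' V' : Matrix n n ℂ} (hU' : U' * U'ᴴ = 1)
    (hV' : V' * V'ᴴ = 1) {p' q' : n → ℝ} (hp' : 0 ≤ p') (hq' : 0 ≤ q')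
    (Ψ : Matrix n n ℂ → Matrix m m ℂ) (hmul : ∀ X Y, Ψ (X * Y) = Ψ X * Ψ Y)
    (hstar : ∀ X, Ψ Xᴴ = (Ψ X)ᴴ)
    (hρ : ∀ Y, (Ψ Y * conjDiag V p).trace = (Y * conjDiag V' p').trace)
    (hσ : ∀ Y, (Ψ Y * conjDiag U q).trace = (Y * conjDiag U' q').trace) :
    ∑ i, ∑ j, Complex.normSq ((U'ᴴ * V') i j) * ((p' j - q' i) ^ 2 / (q' i + s * p' j)) ≤
      ∑ i, ∑ j, Complex.normSq ((Uᴴ * V) i j) * ((p j - q i) ^ 2 / (q i + s * p j)) := by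
  obtain ⟨Y, hY⟩ := exists_quadForm_conjDiag_eq hs hU' hV' hp' hq'
  rw [← hY]
  convert quadForm_conjDiag_le hs hU hV hp hq (Ψ Y) using 1
  rw [quadForm, quadForm, ← hstar, ← hmul, ← hmul, hρ, hσ, hρ, hσ]

end QuadForm

section Integral

open MeasureTheory Set Filter Topology

theorem integral_sq_div {p q : ℝ} (hp : 0 ≤ p) (hq : 0 ≤ q) (h : q = 0 → p = 0) :
    IntegrableOn (fun s => (p - q) ^ 2 / (q + s * p) / (1 + s) ^ 2) (Ioi 0) ∧
    ∫ s in Ioi (0 : ℝ), (p - q) ^ 2 / (q + s * p) / (1 + s) ^ 2 =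
      p * Real.log p - p * Real.log q - p + q := by
  rcases hq.eq_or_lt with rfl | hq
  · simp [h rfl]
  set g : ℝ → ℝ := fun s => p * (Real.log (q + s * p) - Real.log (1 + s)) + (p - q) / (1 + s)
    with hg
  have hderiv : ∀ s ∈ Ici (0 : ℝ),
      HasDerivAt g ((p - q) ^ 2 / (q + s * p) / (1 + s) ^ 2) s := by
    intro s hs
    have hs : 0 ≤ s := hs
    have h1 : 0 < 1 + s := by linarith
    have h2 : 0 < q + s * p := by positivity
    have d1 : HasDerivAt (fun s : ℝ => 1 + s) 1 s := (hasDerivAt_id s).const_add 1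
    have d2 : HasDerivAt (fun s : ℝ => q + s * p) p s := by
      simpa using ((hasDerivAt_id s).mul_const p).const_add q
    have d3 := (((d2.log h2.ne').sub (d1.log h1.ne')).const_mul p).add
      ((hasDerivAt_const s (p - q)).div d1 h1.ne')
    refine d3.congr_deriv ?_
    field_simp
    ring
  have hpos : ∀ s ∈ Ioi (0 : ℝ), 0 ≤ (p - q) ^ 2 / (q + s * p) / (1 + s) ^ 2 := by
    intro s hs
    have hs : 0 < s := hs
    positivity
  have hinv : Tendsto (fun s : ℝ => (1 + s)⁻¹) atTop (𝓝 0) :=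
    tendsto_inv_atTop_zero.comp (tendsto_atTop_add_const_left _ 1 tendsto_id)
  have hlim : Tendsto g atTop (𝓝 (p * Real.log p)) := by
    have t2 : Tendsto (fun s : ℝ => (p - q) / (1 + s)) atTop (𝓝 0) := by
      simpa [div_eq_mul_inv] using hinv.const_mul (p - q)
    rcases hp.eq_or_lt with rfl | hp
    · simpa [hg] using t2
    have t1 : Tendsto (fun s : ℝ => Real.log (p + (q - p) * (1 + s)⁻¹)) atTop
        (𝓝 (Real.log p)) := by
      have : Tendsto (fun s : ℝ => p + (q - p) * (1 + s)⁻¹) atTop (𝓝 p) := by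
        simpa using (hinv.const_mul (q - p)).const_add p
      exact ((Real.continuousAt_log hp.ne').tendsto).comp this
    have t3 := (t1.const_mul p).add t2
    rw [add_zero] at t3
    refine t3.congr' ?_
    filter_upwards [eventually_ge_atTop 0] with s hs
    have h1 : 0 < 1 + s := by linarith
    have h2 : 0 < q + s * p := by positivity
    simp only [hg, ← Real.log_div h2.ne' h1.ne']
    congr 3
    field_simp
    ring
  refine ⟨integrableOn_Ioi_deriv_of_nonneg' hderiv hpos hlim, ?_⟩
  rw [integral_Ioi_of_hasDerivAt_of_nonneg' hderiv hpos hlim]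
  simp [hg]
  ring

theorem integral_sum_sq_div {n : Type} [Fintype n] {p q : n → ℝ} (hp : 0 ≤ p) (hq : 0 ≤ q)
    {w : n → n → ℝ} (hw : ∀ i j, q i = 0 → w i j * p j = 0) :
    IntegrableOn (fun s => (∑ i, ∑ j, w i j * ((p j - q i) ^ 2 / (q i + s * p j))) / (1 + s) ^ 2)
      (Ioi 0) ∧
    ∫ s in Ioi (0 : ℝ), (∑ i, ∑ j, w i j * ((p j - q i) ^ 2 / (q i + s * p j))) / (1 + s) ^ 2 =
      ∑ i, ∑ j, w i j * (p j * Real.log (p j) - p j * Real.log (q i) - p j + q i) := by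
  have key : ∀ i j,
      IntegrableOn (fun s => w i j * ((p j - q i) ^ 2 / (q i + s * p j) / (1 + s) ^ 2)) (Ioi 0) ∧
      ∫ s in Ioi (0 : ℝ), w i j * ((p j - q i) ^ 2 / (q i + s * p j) / (1 + s) ^ 2) =
        w i j * (p j * Real.log (p j) - p j * Real.log (q i) - p j + q i) := by
    intro i j
    by_cases h : w i j = 0
    · simp [h]
    · have := integral_sq_div (hp j) (hq i) fun h0 => by simpa [h] using hw i j h0
      exact ⟨this.1.const_mul _, by rw [integral_const_mul, this.2]⟩
  have e : ∀ s : ℝ, (∑ i, ∑ j, w i j * ((p j - q i) ^ 2 / (q i + s * p j))) / (1 + s) ^ 2 =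
      ∑ i, ∑ j, w i j * ((p j - q i) ^ 2 / (q i + s * p j) / (1 + s) ^ 2) := by
    intro s
    simp only [Finset.sum_div, mul_div_assoc]
  simp only [e]
  refine ⟨integrable_finsetSum _ fun i _ => integrable_finsetSum _ fun j _ => (key i j).1, ?_⟩
  rw [integral_finsetSum _ fun i _ => integrable_finsetSum _ fun j _ => (key i j).1]
  refine Finset.sum_congr rfl fun i _ => ?_
  rw [integral_finsetSum _ fun j _ => (key i j).1]
  exact Finset.sum_congr rfl fun j _ => (key i j).2

theorem sum_relEntropy_le {m n : Type} [Fintype m] [Fintype n]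
    {p q : m → ℝ} (hp : 0 ≤ p) (hq : 0 ≤ q) {w : m → m → ℝ}
    (hw : ∀ i j, q i = 0 → w i j * p j = 0)
    {p' q' : n → ℝ} (hp' : 0 ≤ p') (hq' : 0 ≤ q') {w' : n → n → ℝ}
    (hw' : ∀ i j, q' i = 0 → w' i j * p' j = 0)
    (h : ∀ s : ℝ, 0 < s → ∑ i, ∑ j, w' i j * ((p' j - q' i) ^ 2 / (q' i + s * p' j)) ≤
      ∑ i, ∑ j, w i j * ((p j - q i) ^ 2 / (q i + s * p j))) :
    ∑ i, ∑ j, w' i j * (p' j * Real.log (p' j) - p' j * Real.log (q' i) - p' j + q' i) ≤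
      ∑ i, ∑ j, w i j * (p j * Real.log (p j) - p j * Real.log (q i) - p j + q i) := by
  obtain ⟨i1, e1⟩ := integral_sum_sq_div hp hq hw
  obtain ⟨i2, e2⟩ := integral_sum_sq_div hp' hq' hw'
  rw [← e1, ← e2]
  refine setIntegral_mono_on i2 i1 measurableSet_Ioi fun s hs => ?_
  have := h s hs
  gcongr

end Integral

section MutualInfo

variable {A B : Type} [Fintype A] [DecidableEq A] [Fintype B] [DecidableEq B]

/-- Partial trace over the second tensor factor. -/
def margL (ρ : Matrix (A × B) (A × B) ℂ) : Matrix A A ℂ :=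
  Matrix.of fun a a₂ => ∑ b, ρ (a, b) (a₂, b)

/-- Partial trace over the first tensor factor. -/
def margR (ρ : Matrix (A × B) (A × B) ℂ) : Matrix B B ℂ :=
  Matrix.of fun b b₂ => ∑ a, ρ (a, b) (a, b₂)

omit [DecidableEq A] in
theorem trace_kronecker_one_mul (X : Matrix A A ℂ) (ρ : Matrix (A × B) (A × B) ℂ) :
    ((X ⊗ₖ (1 : Matrix B B ℂ)) * ρ).trace = (X * margL ρ).trace := by
  simp only [Matrix.trace, Matrix.diag_apply, Matrix.mul_apply, Fintype.sum_prod_type,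
    Matrix.kroneckerMap_apply, Matrix.one_apply, mul_ite, mul_one, mul_zero, ite_mul, zero_mul,
    Finset.sum_ite_eq, Finset.mem_univ, if_true, margL, Matrix.of_apply, Finset.mul_sum]
  exact Finset.sum_congr rfl fun _ _ => Finset.sum_comm

omit [DecidableEq B] in
theorem trace_one_kronecker_mul (X : Matrix B B ℂ) (ρ : Matrix (A × B) (A × B) ℂ) :
    (((1 : Matrix A A ℂ) ⊗ₖ X) * ρ).trace = (X * margR ρ).trace := by
  simp only [Matrix.trace, Matrix.diag_apply, Matrix.mul_apply, Fintype.sum_prod_type,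
    Matrix.kroneckerMap_apply, Matrix.one_apply, ite_mul, one_mul, zero_mul, margR,
    Matrix.of_apply, Finset.mul_sum, Finset.sum_ite_irrel, Finset.sum_const_zero,
    Finset.sum_ite_eq, Finset.mem_univ, if_true]
  rw [Finset.sum_comm]
  exact Finset.sum_congr rfl fun _ _ => Finset.sum_comm

omit [DecidableEq A] [DecidableEq B] in
theorem trace_margL (ρ : Matrix (A × B) (A × B) ℂ) : (margL ρ).trace = ρ.trace := by
  simp [Matrix.trace, margL, Fintype.sum_prod_type]

omit [Fintype A] [DecidableEq A] [DecidableEq B] in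
theorem Matrix.PosSemidef.margL {ρ : Matrix (A × B) (A × B) ℂ} (h : ρ.PosSemidef) :
    (margL ρ).PosSemidef := by
  have : _root_.margL ρ = ∑ b, ρ.submatrix (fun a => (a, b)) (fun a => (a, b)) := by
    ext a a₂
    simp [_root_.margL, Matrix.sum_apply]
  rw [this]
  exact Matrix.posSemidef_sum _ fun b _ => h.submatrix _

omit [DecidableEq A] [Fintype B] [DecidableEq B] in
theorem Matrix.PosSemidef.margR {ρ : Matrix (A × B) (A × B) ℂ} (h : ρ.PosSemidef) :
    (margR ρ).PosSemidef := by
  have : _root_.margR ρ = ∑ a, ρ.submatrix (fun b => (a, b)) (fun b => (a, b)) := by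
    ext a a₂
    simp [_root_.margR, Matrix.sum_apply]
  rw [this]
  exact Matrix.posSemidef_sum _ fun b _ => h.submatrix _

theorem conjDiag_eigenvalues {M : Matrix A A ℂ} (h : M.IsHermitian) :
    conjDiag (h.eigenvectorUnitary : Matrix A A ℂ) h.eigenvalues = M := by
  conv_rhs => rw [h.spectral_theorem]
  rfl

theorem trace_conjDiag {U : Matrix A A ℂ} (hU : Uᴴ * U = 1) (p : A → ℝ) :
    (conjDiag U p).trace = ∑ i, (p i : ℂ) := by
  rw [conjDiag, Matrix.trace_mul_comm, ← Matrix.mul_assoc, hU, Matrix.one_mul,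
    Matrix.trace_diagonal]

theorem sum_normSq_row {W : Matrix A A ℂ} (hW : W * Wᴴ = 1) (i : A) :
    ∑ j, Complex.normSq (W i j) = 1 := by
  have := congrFun (congrFun hW i) i
  simp only [Matrix.mul_apply, Matrix.conjTranspose_apply, Matrix.one_apply_eq,
    Complex.star_def, Complex.mul_conj] at this
  exact_mod_cast this

theorem sum_normSq_col {W : Matrix A A ℂ} (hW : Wᴴ * W = 1) (j : A) :
    ∑ i, Complex.normSq (W i j) = 1 := by
  have := congrFun (congrFun hW j) j
  simp only [Matrix.mul_apply, Matrix.conjTranspose_apply, Matrix.one_apply_eq,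
    Complex.star_def, ← Complex.normSq_eq_conj_mul_self] at this
  exact_mod_cast this

theorem sum_normSq_mul_eq_diag (U V : Matrix A A ℂ) (p : A → ℝ) (i : A) :
    ((∑ j, Complex.normSq ((Uᴴ * V) i j) * p j : ℝ) : ℂ) = (Uᴴ * conjDiag V p * U) i i := by
  have : Uᴴ * conjDiag V p * U =
      (Uᴴ * V) * Matrix.diagonal (fun i => (p i : ℂ)) * (Uᴴ * V)ᴴ := by
    simp only [conjDiag, Matrix.conjTranspose_mul, Matrix.conjTranspose_conjTranspose,
      Matrix.mul_assoc]
  rw [this, Matrix.mul_apply, Complex.ofReal_sum]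
  refine Finset.sum_congr rfl fun j _ => ?_
  rw [Matrix.mul_diagonal, Matrix.conjTranspose_apply, Complex.ofReal_mul, ← Complex.mul_conj,
    Complex.star_def]
  ring

theorem conjTranspose_mul_conjDiag_mul {U : Matrix A A ℂ} (hU : Uᴴ * U = 1) (p : A → ℝ) :
    Uᴴ * conjDiag U p * U = Matrix.diagonal fun i => (p i : ℂ) := by
  have : Uᴴ * conjDiag U p * U =
      (Uᴴ * U) * Matrix.diagonal (fun i => (p i : ℂ)) * (Uᴴ * U) := by
    simp only [conjDiag, Matrix.mul_assoc]
  rw [this, hU, Matrix.one_mul, Matrix.mul_one]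

theorem sum_diag_kronecker_left {UA : Matrix A A ℂ} {UB : Matrix B B ℂ}
    (hB : UB * UBᴴ = 1) (ρ : Matrix (A × B) (A × B) ℂ) (k : A) :
    ∑ l, ((UA ⊗ₖ UB)ᴴ * ρ * (UA ⊗ₖ UB)) (k, l) (k, l) = (UAᴴ * margL ρ * UA) k k := by
  have h1 : ∀ {C : Type} [Fintype C] [DecidableEq C] (M : Matrix C C ℂ) (c : C),
      (Matrix.single c c (1 : ℂ) * M).trace = M c c := by
    intro C _ _ M c
    rw [Matrix.trace_single_mul, one_smul]
  have h2 : ∑ l, ((UA ⊗ₖ UB)ᴴ * ρ * (UA ⊗ₖ UB)) (k, l) (k, l) =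
      (margL ((UA ⊗ₖ UB)ᴴ * ρ * (UA ⊗ₖ UB))) k k := rfl
  rw [h2, ← h1 (margL _) k, ← trace_kronecker_one_mul, ← h1 (UAᴴ * margL ρ * UA),
    ← Matrix.mul_assoc, Matrix.trace_mul_comm, ← Matrix.mul_assoc, ← Matrix.mul_assoc,
    Matrix.conjTranspose_kronecker, ← Matrix.mul_kronecker_mul, ← Matrix.mul_kronecker_mul,
    Matrix.mul_one, hB, trace_kronecker_one_mul, ← Matrix.mul_assoc, Matrix.trace_mul_comm _ UA]
  simp only [Matrix.mul_assoc]

theorem sum_diag_kronecker_right {UA : Matrix A A ℂ} {UB : Matrix B B ℂ}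
    (hA : UA * UAᴴ = 1) (ρ : Matrix (A × B) (A × B) ℂ) (l : B) :
    ∑ k, ((UA ⊗ₖ UB)ᴴ * ρ * (UA ⊗ₖ UB)) (k, l) (k, l) = (UBᴴ * margR ρ * UB) l l := by
  have h1 : ∀ {C : Type} [Fintype C] [DecidableEq C] (M : Matrix C C ℂ) (c : C),
      (Matrix.single c c (1 : ℂ) * M).trace = M c c := by
    intro C _ _ M c
    rw [Matrix.trace_single_mul, one_smul]
  have h2 : ∑ k, ((UA ⊗ₖ UB)ᴴ * ρ * (UA ⊗ₖ UB)) (k, l) (k, l) =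
      (margR ((UA ⊗ₖ UB)ᴴ * ρ * (UA ⊗ₖ UB))) l l := rfl
  rw [h2, ← h1 (margR _) l, ← trace_one_kronecker_mul, ← h1 (UBᴴ * margR ρ * UB),
    ← Matrix.mul_assoc, Matrix.trace_mul_comm, ← Matrix.mul_assoc, ← Matrix.mul_assoc,
    Matrix.conjTranspose_kronecker, ← Matrix.mul_kronecker_mul, ← Matrix.mul_kronecker_mul,
    Matrix.mul_one, hA, trace_one_kronecker_mul, ← Matrix.mul_assoc, Matrix.trace_mul_comm _ UB]
  simp only [Matrix.mul_assoc]

/-- Mutual information as the relative entropy between a state and the product of its marginals,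
written in eigenbases of the two. -/
theorem exists_relEntropy_eq_mutualInfo {ρ : Matrix (A × B) (A × B) ℂ} (hρ : IsDensityMatrix ρ) :
    ∃ (U V : Matrix (A × B) (A × B) ℂ) (p q : A × B → ℝ),
      U * Uᴴ = 1 ∧ V * Vᴴ = 1 ∧ 0 ≤ p ∧ 0 ≤ q ∧
      conjDiag V p = ρ ∧ conjDiag U q = margL ρ ⊗ₖ margR ρ ∧
      (∀ i j, q i = 0 → Complex.normSq ((Uᴴ * V) i j) * p j = 0) ∧
      ∑ i, ∑ j, Complex.normSq ((Uᴴ * V) i j) *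
        (p j * Real.log (p j) - p j * Real.log (q i) - p j + q i) =
        matEntropy (margL ρ) + matEntropy (margR ρ) - matEntropy ρ := by
  obtain ⟨hpos, htr⟩ := hρ
  have hL := hpos.margL
  have hR := hpos.margR
  rw [matEntropy_of_isHermitian hL.1, matEntropy_of_isHermitian hR.1,
    matEntropy_of_isHermitian hpos.1]
  have hUA := Matrix.mem_unitaryGroup_iff.mp hL.1.eigenvectorUnitary.2
  have hUB := Matrix.mem_unitaryGroup_iff.mp hR.1.eigenvectorUnitary.2
  have hV := Matrix.mem_unitaryGroup_iff.mp hpos.1.eigenvectorUnitary.2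
  have eA := conjDiag_eigenvalues hL.1
  have eB := conjDiag_eigenvalues hR.1
  have eV := conjDiag_eigenvalues hpos.1
  have a0 := hL.eigenvalues_nonneg
  have b0 := hR.eigenvalues_nonneg
  have p0 := hpos.eigenvalues_nonneg
  rw [Matrix.star_eq_conjTranspose] at hUA hUB hV
  generalize (hL.1.eigenvectorUnitary : Matrix A A ℂ) = UA at hUA eA
  generalize (hR.1.eigenvectorUnitary : Matrix B B ℂ) = UB at hUB eB
  generalize (hpos.1.eigenvectorUnitary : Matrix (A × B) (A × B) ℂ) = V at hV eV
  generalize hL.1.eigenvalues = α at a0 eA ⊢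
  generalize hR.1.eigenvalues = β at b0 eB ⊢
  generalize hpos.1.eigenvalues = p at p0 eV ⊢
  set U := UA ⊗ₖ UB with hUdef
  have hU : U * Uᴴ = 1 := by
    rw [hUdef, Matrix.conjTranspose_kronecker, ← Matrix.mul_kronecker_mul, hUA, hUB,
      Matrix.one_kronecker_one]
  have hW : (Uᴴ * V) * (Uᴴ * V)ᴴ = 1 := by
    calc (Uᴴ * V) * (Uᴴ * V)ᴴ = Uᴴ * (V * Vᴴ) * U := by
          simp only [Matrix.conjTranspose_mul, Matrix.conjTranspose_conjTranspose,
            Matrix.mul_assoc]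
      _ = 1 := by rw [hV, Matrix.mul_one, mul_eq_one_comm.mp hU]
  set d : A × B → ℝ := fun i => ∑ j, Complex.normSq ((Uᴴ * V) i j) * p j with hd
  have d0 : ∀ i, 0 ≤ d i := fun i =>
    Finset.sum_nonneg fun j _ => mul_nonneg (Complex.normSq_nonneg _) (p0 j)
  have dA : ∀ k, ∑ l, d (k, l) = α k := by
    intro k
    have h := sum_diag_kronecker_left (UA := UA) hUB ρ k
    conv_rhs at h => rw [← eA, conjTranspose_mul_conjDiag_mul (mul_eq_one_comm.mp hUA),
      Matrix.diagonal_apply_eq]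
    simp only [← eV, ← hUdef, ← sum_normSq_mul_eq_diag] at h
    exact_mod_cast h
  have dB : ∀ l, ∑ k, d (k, l) = β l := by
    intro l
    have h := sum_diag_kronecker_right (UB := UB) hUA ρ l
    conv_rhs at h => rw [← eB, conjTranspose_mul_conjDiag_mul (mul_eq_one_comm.mp hUB),
      Matrix.diagonal_apply_eq]
    simp only [← eV, ← hUdef, ← sum_normSq_mul_eq_diag] at h
    exact_mod_cast h
  have dA0 : ∀ k l, α k = 0 → d (k, l) = 0 := fun k l h =>
    (Finset.sum_eq_zero_iff_of_nonneg fun l _ => d0 (k, l)).mp ((dA k).trans h) l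
      (Finset.mem_univ _)
  have dB0 : ∀ k l, β l = 0 → d (k, l) = 0 := fun k l h =>
    (Finset.sum_eq_zero_iff_of_nonneg fun k _ => d0 (k, l)).mp ((dB l).trans h) k
      (Finset.mem_univ _)
  have sp : ∑ j, p j = 1 := by
    rw [← eV, trace_conjDiag (mul_eq_one_comm.mp hV)] at htr
    exact_mod_cast htr
  have sd : ∑ i, d i = 1 := by
    rw [hd, Finset.sum_comm]
    simp only [← Finset.sum_mul, sum_normSq_col (mul_eq_one_comm.mp hW), one_mul, sp]
  have sα : ∑ k, α k = 1 := by
    rw [← sd, Fintype.sum_prod_type]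
    simp only [dA]
  have sβ : ∑ k, β k = 1 := by
    rw [← sd, Fintype.sum_prod_type_right]
    simp only [dB]
  refine ⟨U, V, p, fun i => α i.1 * β i.2, hU, hV, p0, fun i => mul_nonneg (a0 _) (b0 _), eV,
    ?_, ?_, ?_⟩
  · rw [← eA, ← eB]
    simp only [conjDiag, hUdef, Matrix.conjTranspose_kronecker, Matrix.mul_kronecker_mul,
      Matrix.diagonal_kronecker_diagonal, Complex.ofReal_mul]
  · rintro ⟨k, l⟩ j h
    have : d (k, l) = 0 := (mul_eq_zero.mp h).elim (dA0 k l) (dB0 k l)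
    exact (Finset.sum_eq_zero_iff_of_nonneg fun j _ =>
      mul_nonneg (Complex.normSq_nonneg _) (p0 j)).mp this j (Finset.mem_univ _)
  · have t1 : ∑ i, ∑ j, Complex.normSq ((Uᴴ * V) i j) * (p j * Real.log (p j)) =
        ∑ j, p j * Real.log (p j) := by
      rw [Finset.sum_comm]
      simp only [← Finset.sum_mul, sum_normSq_col (mul_eq_one_comm.mp hW), one_mul]
    have t2 : ∑ i : A × B, d i * Real.log (α i.1 * β i.2) =
        ∑ k, α k * Real.log (α k) + ∑ l, β l * Real.log (β l) := by
      have : ∀ i : A × B, d i * Real.log (α i.1 * β i.2) =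
          d i * Real.log (α i.1) + d i * Real.log (β i.2) := by
        rintro ⟨k, l⟩
        by_cases hk : α k = 0
        · simp [dA0 k l hk]
        by_cases hl : β l = 0
        · simp [dB0 k l hl]
        rw [Real.log_mul hk hl, mul_add]
      simp only [this, Finset.sum_add_distrib]
      congr 1
      · rw [Fintype.sum_prod_type]
        simp only [← Finset.sum_mul, dA]
      · rw [Fintype.sum_prod_type_right]
        simp only [← Finset.sum_mul, dB]
    have t3 : ∑ i : A × B, ∑ j, Complex.normSq ((Uᴴ * V) i j) * (α i.1 * β i.2) = 1 := by
      simp only [← Finset.sum_mul, sum_normSq_row hW, one_mul]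
      rw [Fintype.sum_prod_type]
      simp only [← Finset.mul_sum, sβ, mul_one, sα]
    have e : ∀ i j, Complex.normSq ((Uᴴ * V) i j) *
        (p j * Real.log (p j) - p j * Real.log (α i.1 * β i.2) - p j + α i.1 * β i.2) =
        Complex.normSq ((Uᴴ * V) i j) * (p j * Real.log (p j))
        - Complex.normSq ((Uᴴ * V) i j) * p j * Real.log (α i.1 * β i.2)
        - Complex.normSq ((Uᴴ * V) i j) * p j
        + Complex.normSq ((Uᴴ * V) i j) * (α i.1 * β i.2) := fun i j => by ring
    simp only [e, Finset.sum_add_distrib, Finset.sum_sub_distrib, t1, t3]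
    simp only [← Finset.sum_mul]
    change _ - ∑ i, d i * _ - ∑ i, d i + 1 = _
    rw [t2, sd]
    simp only [Real.negMulLog, neg_mul, Finset.sum_neg_distrib]
    ring

variable {A₂ B₂ : Type} [Fintype A₂] [DecidableEq A₂] [Fintype B₂] [DecidableEq B₂]

/-- Partial trace over the second factor of each of the two parties. -/
def traceOutBoth (ρ : Matrix ((A × A₂) × (B × B₂)) ((A × A₂) × (B × B₂)) ℂ) :
    Matrix (A × B) (A × B) ℂ :=
  margL (ρ.submatrix (Equiv.prodProdProdComm A B A₂ B₂) (Equiv.prodProdProdComm A B A₂ B₂))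

omit [DecidableEq A] [DecidableEq A₂] [DecidableEq B] [DecidableEq B₂] in
theorem IsDensityMatrix.traceOutBoth {ρ : Matrix ((A × A₂) × (B × B₂)) ((A × A₂) × (B × B₂)) ℂ}
    (hρ : IsDensityMatrix ρ) : IsDensityMatrix (traceOutBoth ρ) := by
  refine ⟨(hρ.1.submatrix _).margL, ?_⟩
  rw [_root_.traceOutBoth, trace_margL, ← hρ.2, Matrix.trace, Matrix.trace]
  exact Equiv.sum_comp (Equiv.prodProdProdComm A B A₂ B₂) fun i => ρ i i

omit [Fintype A] [DecidableEq A] [DecidableEq A₂] [DecidableEq B] [DecidableEq B₂] in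
theorem margL_traceOutBoth (ρ : Matrix ((A × A₂) × (B × B₂)) ((A × A₂) × (B × B₂)) ℂ) :
    margL (traceOutBoth ρ) = margL (margL ρ) := by
  ext a a₂
  simp only [margL, traceOutBoth, Matrix.of_apply, Matrix.submatrix_apply, Fintype.sum_prod_type,
    Equiv.prodProdProdComm_apply]
  exact Finset.sum_comm

omit [DecidableEq A] [DecidableEq A₂] [Fintype B] [DecidableEq B] [DecidableEq B₂] in
theorem margR_traceOutBoth (ρ : Matrix ((A × A₂) × (B × B₂)) ((A × A₂) × (B × B₂)) ℂ) :
    margR (traceOutBoth ρ) = margL (margR ρ) := by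
  ext b b₂
  simp only [margL, margR, traceOutBoth, Matrix.of_apply, Matrix.submatrix_apply,
    Fintype.sum_prod_type, Equiv.prodProdProdComm_apply]
  rw [Finset.sum_comm_cycle]

/-- Mutual information is monotone under partial traces on both parties. -/
theorem mutualInfo_mono {ρ : Matrix ((A × A₂) × (B × B₂)) ((A × A₂) × (B × B₂)) ℂ}
    (hρ : IsDensityMatrix ρ) :
    matEntropy (margL (margL ρ)) + matEntropy (margL (margR ρ)) - matEntropy (traceOutBoth ρ) ≤
      matEntropy (margL ρ) + matEntropy (margR ρ) - matEntropy ρ := by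
  obtain ⟨U, V, p, q, hU, hV, hp, hq, eρ, eσ, hw, e⟩ := exists_relEntropy_eq_mutualInfo hρ
  obtain ⟨U', V', p', q', hU', hV', hp', hq', eρ', eσ', hw', e'⟩ :=
    exists_relEntropy_eq_mutualInfo hρ.traceOutBoth
  rw [margL_traceOutBoth, margR_traceOutBoth] at e' eσ'
  rw [← e, ← e']
  refine sum_relEntropy_le hp hq hw hp' hq' hw' fun s hs => ?_
  set c := Equiv.prodProdProdComm A A₂ B B₂
  have hdual : ∀ (τ : Matrix ((A × A₂) × (B × B₂)) ((A × A₂) × (B × B₂)) ℂ)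
      (Y : Matrix (A × B) (A × B) ℂ),
      ((Y ⊗ₖ (1 : Matrix (A₂ × B₂) (A₂ × B₂) ℂ)).submatrix c c * τ).trace =
        (Y * traceOutBoth τ).trace := by
    intro τ Y
    rw [traceOutBoth, ← trace_kronecker_one_mul]
    have : τ = (τ.submatrix c.symm c.symm).submatrix c c := by simp
    conv_lhs => rw [this, Matrix.submatrix_mul_equiv, Matrix.trace]
    exact Equiv.sum_comp c fun i => ((Y ⊗ₖ (1 : Matrix (A₂ × B₂) (A₂ × B₂) ℂ)) *
      τ.submatrix c.symm c.symm) i i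
  refine quasiEntropy_mono hs hU hV hp hq hU' hV' hp' hq'
    (fun Y => (Y ⊗ₖ (1 : Matrix (A₂ × B₂) (A₂ × B₂) ℂ)).submatrix c c) ?_ ?_ ?_ ?_
  · intro X Y
    rw [Matrix.submatrix_mul_equiv, ← Matrix.mul_kronecker_mul, Matrix.mul_one]
  · intro X
    rw [Matrix.conjTranspose_submatrix, Matrix.conjTranspose_kronecker,
      Matrix.conjTranspose_one]
  · intro Y
    rw [hdual, eρ, eρ']
  · intro Y
    rw [hdual, eσ, eσ']
    congr 2
    ext ⟨a, b⟩ ⟨a₂, b₂⟩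
    simp only [traceOutBoth, margL, Matrix.of_apply, Matrix.submatrix_apply,
      Matrix.kroneckerMap_apply, Fintype.sum_prod_type, Equiv.prodProdProdComm_apply,
      Finset.sum_mul_sum]

end MutualInfo

section VecState

variable {X Y : Type} [Fintype X] [DecidableEq X] [Fintype Y] [DecidableEq Y]

omit [DecidableEq X] in
theorem vecState_posSemidef (ψ : X → ℂ) : (vecState ψ).PosSemidef :=
  Matrix.posSemidef_vecMulVec_self_star ψ

theorem matEntropy_vecState {ψ : X → ℂ} (h : (vecState ψ).trace = 1) :
    matEntropy (vecState ψ) = 0 := by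
  have e : vecState ψ = Matrix.replicateCol Unit ψ * (Matrix.replicateCol Unit ψ)ᴴ := by
    ext x y
    simp [vecState, Matrix.mul_apply]
  have hH := Matrix.isHermitian_conjTranspose_mul_self (Matrix.replicateCol Unit ψ)
  rw [e, matEntropy_mul_comm _ _ (Matrix.isHermitian_mul_conjTranspose_self _) hH]
  refine matEntropy_unique hH ?_
  rw [Matrix.trace_mul_comm, ← e, h]

/-- The two marginals of a bipartite pure state have the same entropy. -/
theorem matEntropy_margL_vecState (ψ : X × Y → ℂ) :
    matEntropy (margL (vecState ψ)) = matEntropy (margR (vecState ψ)) := by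
  set M : Matrix X Y ℂ := Matrix.of fun x y => ψ (x, y)
  have eL : margL (vecState ψ) = M * Mᴴ := by
    ext x x'
    simp [margL, vecState, Matrix.mul_apply, M]
  have eR : margR (vecState ψ) = (Mᴴ * M)ᵀ := by
    ext y y'
    simp [margR, vecState, Matrix.mul_apply, M, mul_comm]
  have h := Matrix.isHermitian_conjTranspose_mul_self M
  rw [eL, eR, matEntropy_transpose h,
    matEntropy_mul_comm _ _ (Matrix.isHermitian_mul_conjTranspose_self M) h]

end VecState

section Reduce

variable {κ : Type} [Fintype κ] [DecidableEq κ] {β : κ → Type} [∀ x, Fintype (β x)]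
  [∀ x, DecidableEq (β x)] {X Y : Type} [Fintype X] [DecidableEq X] [Fintype Y]

/-- A reduced state may be computed in any factorisation of the configurations into a part
equivalent to the configurations on `s` and a part equivalent to those off `s`. -/
theorem matEntropy_reduce [Nonempty (∀ x, β x)] (s : Finset κ) (E : (∀ x, β x) ≃ X × Y)
    (hX : ∀ u v, (E u).1 = (E v).1 ↔ ∀ x, x ∈ s → u x = v x)
    (hY : ∀ u v, (E u).2 = (E v).2 ↔ ∀ x, x ∉ s → u x = v x)
    {ω : Matrix (∀ x, β x) (∀ x, β x) ℂ} (hω : ω.PosSemidef) :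
    matEntropy (reduce s ω) =
      matEntropy (margL (ω.submatrix E.symm E.symm)) := by
  obtain ⟨u₀⟩ := ‹Nonempty (∀ x, β x)›
  let glue (f : ∀ x : {x // x ∈ s}, β x) (h : ∀ x : {x // x ∉ s}, β x) : ∀ x, β x :=
    fun x => if hx : x ∈ s then f ⟨x, hx⟩ else h ⟨x, hx⟩
  let resIn (u : ∀ x, β x) (x : {x // x ∈ s}) : β x := u x
  let resOut (u : ∀ x, β x) (x : {x // x ∉ s}) : β x := u x
  have glue_mem : ∀ f h x (hx : x ∈ s), glue f h x = f ⟨x, hx⟩ := fun f h x hx => dif_pos hx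
  have glue_nmem : ∀ f h x (hx : x ∉ s), glue f h x = h ⟨x, hx⟩ := fun f h x hx => dif_neg hx
  let g : (∀ x : {x // x ∈ s}, β x) ≃ X := Equiv.ofBijective
    (fun f => (E (glue f (resOut u₀))).1) <| by
    constructor
    · intro f f' hf
      funext x
      have := (hX _ _).mp hf x x.2
      rwa [glue_mem _ _ _ x.2, glue_mem _ _ _ x.2] at this
    · intro x
      refine ⟨resIn (E.symm (x, (E u₀).2)), ?_⟩
      have : (E (E.symm (x, (E u₀).2))).1 = x := by rw [E.apply_symm_apply]
      conv_rhs => rw [← this]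
      exact (hX _ _).mpr fun i hi => glue_mem _ _ _ hi
  let h : (∀ x : {x // x ∉ s}, β x) ≃ Y := Equiv.ofBijective
    (fun f => (E (glue (resIn u₀) f)).2) <| by
    constructor
    · intro f f' hf
      funext x
      have := (hY _ _).mp hf x x.2
      rwa [glue_nmem _ _ _ x.2, glue_nmem _ _ _ x.2] at this
    · intro y
      refine ⟨resOut (E.symm ((E u₀).1, y)), ?_⟩
      have : (E (E.symm ((E u₀).1, y))).2 = y := by rw [E.apply_symm_apply]
      conv_rhs => rw [← this]
      exact (hY _ _).mpr fun i hi => glue_nmem _ _ _ hi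
  have hglue : ∀ f f', E.symm (g f, h f') = glue f f' := by
    intro f f'
    rw [Equiv.symm_apply_eq]
    refine Prod.ext ((hX _ _).mpr fun i hi => ?_) ((hY _ _).mpr fun i hi => ?_)
    · rw [glue_mem _ _ _ hi, glue_mem _ _ _ hi]
    · rw [glue_nmem _ _ _ hi, glue_nmem _ _ _ hi]
  have e : reduce s ω = (margL (ω.submatrix E.symm E.symm)).submatrix g g := by
    ext f f'
    simp only [reduce, margL, Matrix.of_apply, Matrix.submatrix_apply]
    rw [← Equiv.sum_comp h]
    simp only [hglue]
    rfl
  rw [e, matEntropy_submatrix_equiv (hω.submatrix _).margL.1]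

end Reduce

section Triple

theorem forall_fin_three_iff {i j k : Fin 3} (hij : i ≠ j) (hik : i ≠ k) (hjk : j ≠ k)
    (P : Fin 3 → Prop) : (∀ x, P x) ↔ P i ∧ P j ∧ P k := by
  have : ∀ i j k : Fin 3, i ≠ j → i ≠ k → j ≠ k → ∀ x, x = i ∨ x = j ∨ x = k := by decide
  refine ⟨fun h => ⟨h i, h j, h k⟩, fun ⟨h1, h2, h3⟩ x => ?_⟩
  rcases this i j k hij hik hjk x with rfl | rfl | rfl <;> assumption

/-- Evaluation of a configuration of three systems, in any order. -/
def tripleEquiv (α : Fin 3 → Type) {i j k : Fin 3} (hij : i ≠ j) (hik : i ≠ k) (hjk : j ≠ k) :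
    (∀ x, α x) ≃ (α i × α j) × α k :=
  Equiv.ofBijective (fun u => ((u i, u j), u k)) <| by
    constructor
    · intro u v h
      simp only [Prod.mk.injEq] at h
      exact funext <| (forall_fin_three_iff hij hik hjk _).mpr ⟨h.1.1, h.1.2, h.2⟩
    · rintro ⟨⟨a, b⟩, c⟩
      have hk : ∀ x : Fin 3, x ≠ i → x ≠ j → k = x :=
        (forall_fin_three_iff hij hik hjk _).mpr (by simp)
      refine ⟨fun x => if h : i = x then h ▸ a else if h' : j = x then h' ▸ b else
        hk x (Ne.symm h) (Ne.symm h') ▸ c, ?_⟩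
      simp [hij, hik, hjk]

theorem tripleEquiv_apply (α : Fin 3 → Type) {i j k : Fin 3} (hij : i ≠ j) (hik : i ≠ k)
    (hjk : j ≠ k) (u : ∀ x, α x) : tripleEquiv α hij hik hjk u = ((u i, u j), u k) := rfl

end Triple

section Purification

variable {α δ : Fin 3 → Type} {i j k : Fin 3}

/-- Evaluation of a configuration of three systems and three ancillas, party by party. -/
def partyEquiv (α δ : Fin 3 → Type) {i j k : Fin 3} (hij : i ≠ j) (hik : i ≠ k) (hjk : j ≠ k) :
    (∀ x, Sum.elim α δ x) ≃ ((α i × δ i) × (α j × δ j)) × (α k × δ k) where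
  toFun u := (((u (.inl i), u (.inr i)), (u (.inl j), u (.inr j))), (u (.inl k), u (.inr k)))
  invFun p := mergeSum ((tripleEquiv α hij hik hjk).symm ((p.1.1.1, p.1.2.1), p.2.1))
    ((tripleEquiv δ hij hik hjk).symm ((p.1.1.2, p.1.2.2), p.2.2))
  left_inv u := by
    funext x
    rcases x with x | x
    · exact congrFun ((tripleEquiv α hij hik hjk).symm_apply_apply fun x => u (.inl x)) x
    · exact congrFun ((tripleEquiv δ hij hik hjk).symm_apply_apply fun x => u (.inr x)) x
  right_inv p := by
    have hα := (tripleEquiv α hij hik hjk).apply_symm_apply ((p.1.1.1, p.1.2.1), p.2.1)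
    have hδ := (tripleEquiv δ hij hik hjk).apply_symm_apply ((p.1.1.2, p.1.2.2), p.2.2)
    rw [tripleEquiv_apply] at hα hδ
    simp only [Prod.mk.injEq] at hα hδ
    simp only [mergeSum, hα, hδ]

theorem partyFinset_id (k : Fin 3) :
    partyFinset (id : Fin 3 → Fin 3) k = {Sum.inl k, Sum.inr k} := by
  ext x
  simp only [partyFinset, id, Finset.mem_union, Finset.mem_image, Finset.mem_filter,
    Finset.mem_univ, true_and, Finset.mem_singleton, Finset.mem_insert]
  constructor
  · rintro (⟨a, rfl, rfl⟩ | rfl) <;> simp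
  · rintro (rfl | rfl) <;> simp

theorem forall_mem_partyFinset (P : Fin 3 ⊕ Fin 3 → Prop) :
    (∀ x, x ∈ partyFinset id k → P x) ↔ P (.inl k) ∧ P (.inr k) := by
  simp [partyFinset_id]

theorem forall_notMem_partyFinset (hij : i ≠ j) (hik : i ≠ k) (hjk : j ≠ k)
    (P : Fin 3 ⊕ Fin 3 → Prop) :
    (∀ x, x ∉ partyFinset id k → P x) ↔
      (P (.inl i) ∧ P (.inr i)) ∧ (P (.inl j) ∧ P (.inr j)) := by
  rw [Sum.forall, forall_fin_three_iff hij hik hjk, forall_fin_three_iff hij hik hjk]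
  simp only [partyFinset_id, Finset.mem_insert, Finset.mem_singleton, Sum.inl.injEq,
    Sum.inr.injEq, reduceCtorEq, hik, hjk, or_false, false_or, not_false_eq_true, not_true_eq_false,
    forall_const, false_imp_iff, and_true]
  exact and_and_and_comm

theorem forall_notMem_singleton (hij : i ≠ j) (hik : i ≠ k) (hjk : j ≠ k) (P : Fin 3 → Prop) :
    (∀ x, x ∉ ({k} : Finset (Fin 3)) → P x) ↔ P i ∧ P j := by
  rw [forall_fin_three_iff hij hik hjk]
  simp [hik, hjk]

theorem forall_notMem_pair (hij : i ≠ j) (hik : i ≠ k) (hjk : j ≠ k) (P : Fin 3 → Prop) :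
    (∀ x, x ∉ ({i, j} : Finset (Fin 3)) → P x) ↔ P k := by
  rw [forall_fin_three_iff hij hik hjk]
  simp [hik.symm, hjk.symm]

end Purification

section ReduceTriple

variable {κ : Type} [Fintype κ] [DecidableEq κ] {β : κ → Type} [∀ x, Fintype (β x)]
  [∀ x, DecidableEq (β x)] [Nonempty (∀ x, β x)]
  {X Y Z : Type} [Fintype X] [Fintype Y] [Fintype Z] {ω : Matrix (∀ x, β x) (∀ x, β x) ℂ}

theorem matEntropy_reduce_snd [DecidableEq Y] (s : Finset κ) (E : (∀ x, β x) ≃ X × Y)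
    (hY : ∀ u v, (∀ x, x ∈ s → u x = v x) ↔ (E u).2 = (E v).2)
    (hX : ∀ u v, (∀ x, x ∉ s → u x = v x) ↔ (E u).1 = (E v).1) (hω : ω.PosSemidef) :
    matEntropy (reduce s ω) = matEntropy (margR (ω.submatrix E.symm E.symm)) :=
  matEntropy_reduce s (E.trans (Equiv.prodComm _ _)) (fun u v => (hY u v).symm)
    (fun u v => (hX u v).symm) hω

theorem matEntropy_reduce_fst_fst [DecidableEq X] (s : Finset κ) (E : (∀ x, β x) ≃ (X × Y) × Z)
    (hX : ∀ u v, (∀ x, x ∈ s → u x = v x) ↔ (E u).1.1 = (E v).1.1)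
    (hYZ : ∀ u v, (∀ x, x ∉ s → u x = v x) ↔ (E u).1.2 = (E v).1.2 ∧ (E u).2 = (E v).2)
    (hω : ω.PosSemidef) :
    matEntropy (reduce s ω) = matEntropy (margL (margL (ω.submatrix E.symm E.symm))) := by
  rw [matEntropy_reduce s (E.trans (Equiv.prodAssoc _ _ _)) (fun u v => (hX u v).symm)
    (fun u v => Prod.ext_iff.trans (hYZ u v).symm) hω]
  congr 1
  ext x y
  simp only [margL, Matrix.of_apply, Fintype.sum_prod_type]
  rfl

theorem matEntropy_reduce_fst_snd [DecidableEq Y] (s : Finset κ) (E : (∀ x, β x) ≃ (X × Y) × Z)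
    (hY : ∀ u v, (∀ x, x ∈ s → u x = v x) ↔ (E u).1.2 = (E v).1.2)
    (hXZ : ∀ u v, (∀ x, x ∉ s → u x = v x) ↔ (E u).1.1 = (E v).1.1 ∧ (E u).2 = (E v).2)
    (hω : ω.PosSemidef) :
    matEntropy (reduce s ω) = matEntropy (margR (margL (ω.submatrix E.symm E.symm))) :=
  matEntropy_reduce_fst_fst s (E.trans ((Equiv.prodComm _ _).prodCongr (Equiv.refl _))) hY hXZ hω

end ReduceTriple

section Purification

variable {α δ : Fin 3 → Type} [∀ i, Fintype (α i)] [∀ i, DecidableEq (α i)]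
  [∀ i, Fintype (δ i)] [∀ i, DecidableEq (δ i)] {i j k : Fin 3}

/-- `ρ` is the reduction of the state `ω` of systems and ancillas to the systems. -/
def IsReduction (ω : Matrix (∀ x, Sum.elim α δ x) (∀ x, Sum.elim α δ x) ℂ)
    (ρ : Matrix (∀ x, α x) (∀ x, α x) ℂ) : Prop :=
  ∀ f g, ∑ h : ∀ x, δ x, ω (mergeSum f h) (mergeSum g h) = ρ f g

/-- The state `ω` of systems and ancillas, grouped into the systems of the first two parties,
their ancillas, and the third party. -/
def regroup (ω : Matrix (∀ x, Sum.elim α δ x) (∀ x, Sum.elim α δ x) ℂ)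
    (hij : i ≠ j) (hik : i ≠ k) (hjk : j ≠ k) :
    Matrix (((α i × α j) × (δ i × δ j)) × (α k × δ k))
      (((α i × α j) × (δ i × δ j)) × (α k × δ k)) ℂ :=
  let e := ((partyEquiv α δ hij hik hjk).trans
    ((Equiv.prodProdProdComm _ _ _ _).prodCongr (Equiv.refl _))).symm
  ω.submatrix e e

omit [∀ i, Fintype (α i)] [∀ i, DecidableEq (α i)] [∀ i, DecidableEq (δ i)] in
theorem IsReduction.submatrix_eq {ω : Matrix (∀ x, Sum.elim α δ x) (∀ x, Sum.elim α δ x) ℂ}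
    {ρ : Matrix (∀ x, α x) (∀ x, α x) ℂ} (h : IsReduction ω ρ)
    (hij : i ≠ j) (hik : i ≠ k) (hjk : j ≠ k) :
    ρ.submatrix (tripleEquiv α hij hik hjk).symm (tripleEquiv α hij hik hjk).symm =
      traceOutBoth (regroup ω hij hik hjk) := by
  ext x y
  rw [Matrix.submatrix_apply, ← h, ← Equiv.sum_comp (tripleEquiv δ hij hik hjk).symm]
  rfl

theorem nonempty_of_trace_eq_one {X : Type} [Fintype X] {M : Matrix X X ℂ} (h : M.trace = 1) :
    Nonempty X := by
  by_contra hX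
  rw [not_nonempty_iff] at hX
  simp [Matrix.trace] at h

theorem trace_submatrix_equiv {X Y : Type} [Fintype X] [Fintype Y] (M : Matrix X X ℂ) (e : Y ≃ X) :
    (M.submatrix e e).trace = M.trace :=
  Equiv.sum_comp e fun x => M x x

omit [∀ i, DecidableEq (α i)] [∀ i, DecidableEq (δ i)] in
theorem IsReduction.trace_eq {ω : Matrix (∀ x, Sum.elim α δ x) (∀ x, Sum.elim α δ x) ℂ}
    {ρ : Matrix (∀ x, α x) (∀ x, α x) ℂ} (h : IsReduction ω ρ) : ω.trace = ρ.trace := by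
  have hij : (0 : Fin 3) ≠ 1 := by decide
  have hik : (0 : Fin 3) ≠ 2 := by decide
  have hjk : (1 : Fin 3) ≠ 2 := by decide
  have h1 := congrArg Matrix.trace (h.submatrix_eq hij hik hjk)
  rw [traceOutBoth, trace_margL, trace_submatrix_equiv, trace_submatrix_equiv, regroup,
    trace_submatrix_equiv] at h1
  exact h1.symm

/-- `I(AA' : BB') ≥ I(A : B)`, with the joint entropy of `AA'BB'` replaced by that of `CC'`. -/
theorem mutualInfo_le_of_isReduction (hij : i ≠ j) (hik : i ≠ k) (hjk : j ≠ k)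
    {ψ : (∀ x, Sum.elim α δ x) → ℂ} {ρ : Matrix (∀ x, α x) (∀ x, α x) ℂ}
    (hρ : IsDensityMatrix ρ) (h : IsReduction (vecState ψ) ρ) :
    matEntropy (reduce {i} ρ) + matEntropy (reduce {j} ρ) - matEntropy (reduce {i, j} ρ) ≤
      matEntropy (reduce (partyFinset id i) (vecState ψ)) +
      matEntropy (reduce (partyFinset id j) (vecState ψ)) -
      matEntropy (reduce (partyFinset id k) (vecState ψ)) := by
  have hωp := vecState_posSemidef ψ
  have htr : (vecState ψ).trace = 1 := h.trace_eq.trans hρ.2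
  have := nonempty_of_trace_eq_one htr
  have := nonempty_of_trace_eq_one hρ.2
  set E := partyEquiv α δ hij hik hjk
  set t := tripleEquiv α hij hik hjk
  set T := vecState (ψ ∘ E.symm)
  have hTd : IsDensityMatrix (margL T) :=
    ⟨(vecState_posSemidef _).margL, by
      rw [trace_margL, ← htr]; exact trace_submatrix_equiv (vecState ψ) E.symm⟩
  have hρT : margL (ρ.submatrix t.symm t.symm) = traceOutBoth (margL T) := by
    rw [h.submatrix_eq hij hik hjk, margL_traceOutBoth]
    rfl
  have key := mutualInfo_mono hTd
  rw [matEntropy_margL_vecState, ← margL_traceOutBoth, ← margR_traceOutBoth, ← hρT] at key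
  rw [matEntropy_reduce_fst_fst {i} t (fun u v => by simp [t, tripleEquiv_apply])
      (fun u v => forall_notMem_singleton hjk hij.symm hik.symm _) hρ.1,
    matEntropy_reduce_fst_snd {j} t (fun u v => by simp [t, tripleEquiv_apply])
      (fun u v => forall_notMem_singleton hik hij hjk.symm _) hρ.1,
    matEntropy_reduce {i, j} t (fun u v => by simp [t, tripleEquiv_apply])
      (fun u v => (forall_notMem_pair hij hik hjk fun x => u x = v x).symm) hρ.1,
    matEntropy_reduce_fst_fst (partyFinset id i) E
      (fun u v => (forall_mem_partyFinset _).trans Prod.mk_inj.symm)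
      (fun u v => (forall_notMem_partyFinset hjk hij.symm hik.symm _).trans
        (and_congr Prod.mk_inj.symm Prod.mk_inj.symm)) hωp,
    matEntropy_reduce_fst_snd (partyFinset id j) E
      (fun u v => (forall_mem_partyFinset _).trans Prod.mk_inj.symm)
      (fun u v => (forall_notMem_partyFinset hik hij hjk.symm _).trans
        (and_congr Prod.mk_inj.symm Prod.mk_inj.symm)) hωp,
    matEntropy_reduce_snd (partyFinset id k) E
      (fun u v => (forall_mem_partyFinset _).trans Prod.mk_inj.symm)
      (fun u v => (forall_notMem_partyFinset hij hik hjk _).trans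
        ((and_congr Prod.mk_inj.symm Prod.mk_inj.symm).trans Prod.mk_inj.symm)) hωp]
  exact key

/-- `I(AA'BB' : CC') ≥ I(AB : C)`, where the left side is twice the entropy of `CC'`. -/
theorem mutualInfo_le_two_mul_of_isReduction (hij : i ≠ j) (hik : i ≠ k) (hjk : j ≠ k)
    {ψ : (∀ x, Sum.elim α δ x) → ℂ} {ρ : Matrix (∀ x, α x) (∀ x, α x) ℂ}
    (hρ : IsDensityMatrix ρ) (h : IsReduction (vecState ψ) ρ) :
    matEntropy (reduce {i, j} ρ) + matEntropy (reduce {k} ρ) - matEntropy ρ ≤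
      2 * matEntropy (reduce (partyFinset id k) (vecState ψ)) := by
  have hωp := vecState_posSemidef ψ
  have htr : (vecState ψ).trace = 1 := h.trace_eq.trans hρ.2
  have := nonempty_of_trace_eq_one htr
  have := nonempty_of_trace_eq_one hρ.2
  set E := (partyEquiv α δ hij hik hjk).trans
    ((Equiv.prodProdProdComm _ _ _ _).prodCongr (Equiv.refl _))
  set t := tripleEquiv α hij hik hjk
  set T := vecState (ψ ∘ E.symm)
  have hT1 : T.trace = 1 := by
    rw [← htr]; exact trace_submatrix_equiv (vecState ψ) E.symm
  have hρT : ρ.submatrix t.symm t.symm = traceOutBoth T := h.submatrix_eq hij hik hjk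
  have key := mutualInfo_mono ⟨vecState_posSemidef _, hT1⟩
  rw [matEntropy_vecState hT1, matEntropy_margL_vecState, ← margL_traceOutBoth,
    ← margR_traceOutBoth, ← hρT, matEntropy_submatrix_equiv hρ.1.1] at key
  rw [matEntropy_reduce {i, j} t (fun u v => by simp [t, tripleEquiv_apply])
      (fun u v => (forall_notMem_pair hij hik hjk fun x => u x = v x).symm) hρ.1,
    matEntropy_reduce_snd {k} t (fun u v => by simp [t, tripleEquiv_apply])
      (fun u v => (forall_notMem_singleton hij hik hjk _).trans Prod.mk_inj.symm) hρ.1,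
    matEntropy_reduce_snd (partyFinset id k) (partyEquiv α δ hij hik hjk)
      (fun u v => (forall_mem_partyFinset _).trans Prod.mk_inj.symm)
      (fun u v => (forall_notMem_partyFinset hij hik hjk _).trans
        ((and_congr Prod.mk_inj.symm Prod.mk_inj.symm).trans Prod.mk_inj.symm)) hωp]
  have hR : margR ((vecState ψ).submatrix (partyEquiv α δ hij hik hjk).symm
      (partyEquiv α δ hij hik hjk).symm) = margR T := by
    ext x y
    exact (Equiv.sum_comp (Equiv.prodProdProdComm (α i) (δ i) (α j) (δ j)).symm fun z =>
      vecState (ψ ∘ (partyEquiv α δ hij hik hjk).symm) (z, x) (z, y)).symm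
  rw [hR]
  linarith

open scoped MatrixOrder Matrix.Norms.L2Operator in
theorem exists_purifies {ρ : Matrix (∀ x, α x) (∀ x, α x) ℂ} (hρ : ρ.PosSemidef) :
    ∃ (d : Fin 3 → ℕ) (ψ : (∀ x : Fin 3 ⊕ Fin 3, Sum.elim α (fun k => Fin (d k)) x) → ℂ),
      Purifies ψ ρ := by
  classical
  obtain ⟨B, rfl⟩ := CStarAlgebra.nonneg_iff_eq_star_mul_self.mp hρ.nonneg
  let ι (x : ∀ x, α x) (_ : Fin 3) : Fin (Fintype.card (∀ x, α x)) := Fintype.equivFin _ x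
  have hι : Function.Injective ι := fun x y h => (Fintype.equivFin _).injective (congrFun h 0)
  refine ⟨fun _ => Fintype.card (∀ x, α x), fun u =>
    Function.extend ι (fun x => star (B x fun a => u (.inl a))) 0 fun k => u (.inr k), ?_⟩
  intro f g
  rw [Matrix.star_eq_conjTranspose, Matrix.mul_apply]
  symm
  refine Fintype.sum_of_injective ι hι _ _ (fun h hh => ?_) fun x => ?_
  · change Function.extend ι (fun x => star (B x f)) 0 h *
      star (Function.extend ι (fun x => star (B x g)) 0 h) = 0
    rw [Function.extend_apply' _ _ _ hh, Pi.zero_apply, zero_mul]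
  · change Bᴴ f x * B x g = Function.extend ι (fun x => star (B x f)) 0 (ι x) *
      star (Function.extend ι (fun x => star (B x g)) 0 (ι x))
    rw [hι.extend_apply, hι.extend_apply, star_star, Matrix.conjTranspose_apply]

end Purification

/-- lower bound for the tripartite entanglement of purification:
`Δ_P(A:B:C) ≥ max{S_A+S_B+S_C−S_{ABC}, 2(S_A+S_B+S_C)−S_{AB}−S_{BC}−S_{CA}}`.
Subsystems `A, B, C` are indexed by `0, 1, 2 : Fin 3`. -/
theorem DeltaP_tripartite_lower_bound {α : Fin 3 → Type}
    [∀ i, Fintype (α i)] [∀ i, DecidableEq (α i)]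
    (ρ : Matrix (∀ i, α i) (∀ i, α i) ℂ) (hρ : IsDensityMatrix ρ) :
    max (matEntropy (reduce {0} ρ) + matEntropy (reduce {1} ρ)
          + matEntropy (reduce {2} ρ) - matEntropy ρ)
        (2 * (matEntropy (reduce {0} ρ) + matEntropy (reduce {1} ρ)
            + matEntropy (reduce {2} ρ))
          - matEntropy (reduce ({0, 1} : Finset (Fin 3)) ρ)
          - matEntropy (reduce ({1, 2} : Finset (Fin 3)) ρ)
          - matEntropy (reduce ({2, 0} : Finset (Fin 3)) ρ))
    ≤ DeltaPart id ρ := by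
  obtain ⟨d₀, ψ₀, h₀⟩ := exists_purifies hρ.1
  refine le_csInf ⟨_, d₀, ψ₀, h₀, rfl⟩ ?_
  rintro _ ⟨d, ψ, hψ, rfl⟩
  have hψ' : IsReduction (δ := fun k => Fin (d k)) (vecState ψ) ρ := hψ
  rw [Fin.sum_univ_three]
  have h01 := mutualInfo_le_of_isReduction (i := 0) (j := 1) (k := 2)
    (by decide) (by decide) (by decide) hρ hψ'
  have h12 := mutualInfo_le_of_isReduction (i := 1) (j := 2) (k := 0)
    (by decide) (by decide) (by decide) hρ hψ'
  have h20 := mutualInfo_le_of_isReduction (i := 2) (j := 0) (k := 1)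
    (by decide) (by decide) (by decide) hρ hψ'
  have h2 := mutualInfo_le_two_mul_of_isReduction (i := 0) (j := 1) (k := 2)
    (by decide) (by decide) (by decide) hρ hψ'
  apply max_le <;> linarith
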